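/- For every n ∈ ℕ, T > 0, every A ∈ C¹([0,T]; ℝ^{n×n}), every F ∈ C¹([0,T]; ℝⁿ) and every c₀ ∈ ℝⁿ, there exists a unique c ∈ C([0,T]; ℝⁿ) with c(0) = c₀, differentiable on (0,T] with t ↦ t^{1-γ} c'(t) extending continuously to [0,T], which satisfies the Volterra integral equation c(t) = c₀ - ∫₀ᵗ g(t-τ) A(τ) c(τ) dτ + ∫₀ᵗ g(t-τ) F(τ) dτ for all t ∈ [0,T]. -/

import Mathlib

open MeasureTheory Real Set

/-- A solution, in the class `X(T)` (continuous on `[0,T]`, with `t^{1-γ} c'(t)`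
extending continuously to `[0,T]`), of the Volterra integral equation
`c(t) = c₀ - ∫₀ᵗ g(t-τ) A(τ) c(τ) dτ + ∫₀ᵗ g(t-τ) F(τ) dτ`. -/
def IsVolterraSol (g : ℝ → ℝ) (γ T : ℝ) (n : ℕ) (A : ℝ → Fin n → Fin n → ℝ)
    (F : ℝ → Fin n → ℝ) (c₀ : Fin n → ℝ) (c : ℝ → Fin n → ℝ) : Prop :=
  ContinuousOn c (Icc 0 T) ∧ c 0 = c₀ ∧
  (∃ c' : ℝ → Fin n → ℝ,
    (∀ t ∈ Ioc (0:ℝ) T, HasDerivWithinAt c (c' t) (Icc 0 T) t) ∧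
    (∃ h : ℝ → Fin n → ℝ, ContinuousOn h (Icc 0 T) ∧
      ∀ t ∈ Ioc (0:ℝ) T, h t = t ^ (1 - γ) • c' t)) ∧
  ∀ t ∈ Icc (0:ℝ) T,
    c t = c₀ - (∫ τ in (0:ℝ)..t, g (t - τ) • (fun i => ∑ j, A τ i j * c τ j))
            + ∫ τ in (0:ℝ)..t, g (t - τ) • F τ

lemma integrableOn_bounded_mul_rpow_mul {μ : ℝ → ℝ} (hμ : IntegrableOn μ (Ioo 0 1))
    {f : ℝ → ℝ} (hf : Continuous f) (hf1 : ∀ x, |f x| ≤ 1) {r : ℝ} (hr : 0 < r) :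
    IntegrableOn (fun α => f α * r ^ α * μ α) (Ioo 0 1) := by
  refine Integrable.bdd_mul (c := max 1 r) hμ ?_ ?_
  · exact (hf.mul (continuous_const.rpow continuous_id fun _ => Or.inl hr.ne')).aestronglyMeasurable
  · filter_upwards [ae_restrict_mem measurableSet_Ioo] with α hα
    have h1 : r ^ α ≤ max 1 r := by
      rcases le_total 1 r with h | h
      · exact (rpow_le_rpow_of_exponent_le h hα.2.le).trans (by simp)
      · exact (rpow_le_one hr.le h hα.1.le).trans (by simp)
    rw [norm_mul, norm_eq_abs, norm_eq_abs, abs_of_pos (rpow_pos_of_pos hr _)]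
    nlinarith [hf1 α, rpow_pos_of_pos hr α, abs_nonneg (f α)]

lemma exists_subinterval_integral_pos {μ : ℝ → ℝ} {a b : ℝ} (hab : a < b)
    (hμ : IntegrableOn μ (Ioo a b)) (hpos : 0 < ∫ α in Ioo a b, μ α) :
    ∃ β ∈ Ioo a b, 0 < ∫ α in Ioo β b, μ α := by
  have hI : IntervalIntegrable μ volume a b := by
    rwa [intervalIntegrable_iff_integrableOn_Ioo_of_le hab.le]
  have hc : ContinuousOn (fun x => ∫ α in x..b, μ α) (uIcc a b) := by
    have := (intervalIntegral.continuousOn_primitive_interval' hI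
      (right_mem_uIcc (a := a) (b := b))).neg
    refine this.congr fun x _ => ?_
    rw [Pi.neg_apply, intervalIntegral.integral_symm]
  have h0 : 0 < ∫ α in a..b, μ α := by
    rwa [intervalIntegral.integral_of_le hab.le, integral_Ioc_eq_integral_Ioo]
  have hsub : Ioo a b ⊆ uIcc a b := fun x hx => Icc_subset_uIcc (Ioo_subset_Icc_self hx)
  have h1 := (hc a left_mem_uIcc).mono hsub
  have : (nhdsWithin a (Ioo a b)).NeBot := by
    rw [nhdsWithin_Ioo_eq_nhdsGT hab]; infer_instance
  obtain ⟨β, h2, hβ⟩ := ((h1.eventually (lt_mem_nhds h0)).and self_mem_nhdsWithin).exists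
  refine ⟨β, hβ, ?_⟩
  rwa [intervalIntegral.integral_of_le hβ.2.le, integral_Ioc_eq_integral_Ioo] at h2

lemma exists_lower_bound_integral_sin_mul_rpow {μ : ℝ → ℝ} (hμ : IntegrableOn μ (Ioo 0 1))
    (hμ0 : ∀ α ∈ Ioo (0:ℝ) 1, 0 ≤ μ α) {γ : ℝ} (hγ : γ ∈ Ioo (0:ℝ) (1/2))
    (hpos : 0 < ∫ α in Ioo γ (1 - γ), μ α) :
    ∃ β ∈ Ioo γ (1 - γ), ∃ m > 0, ∀ r > 0,
      m * min (r ^ β) (r ^ (1 - γ)) ≤ ∫ α in Ioo (0:ℝ) 1, sin (π * α) * r ^ α * μ α := by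
  obtain ⟨hγ0, hγ1⟩ := hγ
  have hsub : Ioo γ (1 - γ) ⊆ Ioo 0 1 := Ioo_subset_Ioo hγ0.le (by linarith)
  obtain ⟨β, hβ, hm⟩ := exists_subinterval_integral_pos (by linarith) (hμ.mono_set hsub) hpos
  have hsub' : Ioo β (1 - γ) ⊆ Ioo 0 1 := (Ioo_subset_Ioo_left hβ.1.le).trans hsub
  have hs : 0 < sin (π * γ) :=
    sin_pos_of_pos_of_lt_pi (by positivity) (by nlinarith [pi_pos])
  refine ⟨β, hβ, sin (π * γ) * ∫ α in Ioo β (1 - γ), μ α, by positivity, fun r hr => ?_⟩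
  have hint := integrableOn_bounded_mul_rpow_mul hμ (f := fun α => sin (π * α)) (by fun_prop)
    (fun x => abs_sin_le_one _) hr
  calc _ = ∫ α in Ioo β (1 - γ), sin (π * γ) * min (r ^ β) (r ^ (1 - γ)) * μ α := by
        rw [integral_const_mul]; ring
    _ ≤ ∫ α in Ioo β (1 - γ), sin (π * α) * r ^ α * μ α := by
        refine setIntegral_mono_on ((hμ.mono_set hsub').const_mul _) (hint.mono_set hsub')
          measurableSet_Ioo fun α hα => ?_
        refine mul_le_mul_of_nonneg_right ?_ (hμ0 α (hsub' hα))
        have h1 : sin (π * γ) ≤ sin (π * α) := by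
          have hπ := pi_pos
          have hαγ : γ < α := hβ.1.trans hα.1
          rcases le_total α (1/2) with h | h
          · exact sin_le_sin_of_le_of_le_pi_div_two (by nlinarith) (by nlinarith) (by nlinarith)
          · rw [← sin_pi_sub (π * α)]
            exact sin_le_sin_of_le_of_le_pi_div_two (by nlinarith) (by nlinarith)
              (by nlinarith [hα.2])
        have h2 : min (r ^ β) (r ^ (1 - γ)) ≤ r ^ α := by
          rcases le_total 1 r with h | h
          · exact (min_le_left _ _).trans (rpow_le_rpow_of_exponent_le h hα.1.le)
          · exact (min_le_right _ _).trans (rpow_le_rpow_of_exponent_ge hr h hα.2.le)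
        have h3 : 0 ≤ min (r ^ β) (r ^ (1 - γ)) := by positivity
        exact mul_le_mul h1 h2 h3 (hs.le.trans h1)
    _ ≤ _ := by
        refine setIntegral_mono_set hint ?_ (Filter.Eventually.of_forall hsub')
        filter_upwards [ae_restrict_mem measurableSet_Ioo] with α hα
        have : 0 ≤ sin (π * α) :=
          sin_nonneg_of_nonneg_of_le_pi (by nlinarith [pi_pos, hα.1]) (by nlinarith [pi_pos, hα.2])
        have := hμ0 α hα
        simp only [Pi.zero_apply]
        positivity

lemma measurable_integral_mul_rpow_mul {μ : ℝ → ℝ} (hμ : IntegrableOn μ (Ioo 0 1))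
    {f : ℝ → ℝ} (hf : Continuous f) :
    Measurable fun r : ℝ => ∫ α in Ioo (0:ℝ) 1, f α * r ^ α * μ α := by
  have hν := hμ.aestronglyMeasurable
  have : (fun r : ℝ => ∫ α in Ioo (0:ℝ) 1, f α * r ^ α * μ α) =
      fun r : ℝ => ∫ α in Ioo (0:ℝ) 1, f α * r ^ α * hν.mk μ α := by
    funext r
    refine integral_congr_ae ?_
    filter_upwards [hν.ae_eq_mk] with α hα
    rw [← hα]
  rw [this]
  refine StronglyMeasurable.measurable (StronglyMeasurable.integral_prod_right
    (f := fun r α => f α * r ^ α * hν.mk μ α) (Measurable.stronglyMeasurable ?_))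
  have := hν.stronglyMeasurable_mk.measurable
  have := hf.measurable
  unfold Function.uncurry
  fun_prop

/-- Laplace transforms of densities bounded by `r^{-β} + r^{γ-1}`. -/
lemma continuousOn_rpow_mul_laplace {ρ : ℝ → ℝ} (hρ : Measurable ρ) {β γ M : ℝ} (hγ : 0 < γ)
    (hγ1 : γ < 1 / 2) (hβγ : γ < β) (hβ : β < 1)
    (hρb : ∀ r > 0, |ρ r| ≤ M * (r ^ (-β) + r ^ (γ - 1))) :
    ContinuousOn (fun t => if t ≤ 0 then 0 else
      t ^ (1 - γ) * ∫ r in Ioi (0:ℝ), exp (-r * t) * ρ r) (Ici 0) := by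
  have hi1 : ∀ t > 0, IntegrableOn (fun r : ℝ => r ^ (-β) * exp (-(t * r))) (Ioi 0) := fun t ht => by
    simpa using integrableOn_rpow_mul_exp_neg_mul_rpow (s := -β) (p := 1) (b := t)
      (by linarith) one_pos ht
  have hi2 : ∀ t > 0, IntegrableOn (fun r : ℝ => r ^ (γ - 1) * exp (-(t * r))) (Ioi 0) := fun t ht => by
    simpa using integrableOn_rpow_mul_exp_neg_mul_rpow (s := γ - 1) (p := 1) (b := t)
      (by linarith) one_pos ht
  have hi : ∀ t > 0, IntegrableOn (fun r : ℝ => M * (r ^ (-β) + r ^ (γ - 1)) * exp (-(t * r)))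
      (Ioi 0) := fun t ht => by
    refine (((hi1 t ht).add (hi2 t ht)).const_mul M).congr (Filter.Eventually.of_forall fun r => ?_)
    simp only [Pi.add_apply]; ring
  have hbd : ∀ t, ∀ r > 0, ‖exp (-r * t) * ρ r‖ ≤ M * (r ^ (-β) + r ^ (γ - 1)) * exp (-(t * r)) := by
    intro t r hr
    rw [norm_mul, norm_eq_abs, abs_of_pos (exp_pos _), mul_comm, show -r * t = -(t * r) by ring]
    exact mul_le_mul_of_nonneg_right (hρb r hr) (exp_pos _).le
  intro t₀ ht₀
  rcases eq_or_lt_of_le (show (0:ℝ) ≤ t₀ from ht₀) with rfl | ht₀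
  · have hb : ∀ t ∈ Ici (0:ℝ), ‖(if t ≤ 0 then 0 else
        t ^ (1 - γ) * ∫ r in Ioi (0:ℝ), exp (-r * t) * ρ r)‖ ≤
        M * (Gamma (1 - β) * t ^ (β - γ) + Gamma γ * t ^ (1 - 2 * γ)) := by
      intro t ht
      rcases eq_or_lt_of_le (show (0:ℝ) ≤ t from ht) with rfl | ht
      · rw [if_pos le_rfl, zero_rpow (by linarith), zero_rpow (by linarith)]; simp
      · rw [if_neg ht.not_ge, norm_mul, norm_eq_abs, abs_of_pos (rpow_pos_of_pos ht _)]
        have h1 : ‖∫ r in Ioi (0:ℝ), exp (-r * t) * ρ r‖ ≤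
            ∫ r in Ioi (0:ℝ), M * (r ^ (-β) + r ^ (γ - 1)) * exp (-(t * r)) :=
          norm_integral_le_of_norm_le (hi t ht) (by
            filter_upwards [ae_restrict_mem measurableSet_Ioi] with r hr using hbd t r hr)
        have h2 : ∫ r in Ioi (0:ℝ), M * (r ^ (-β) + r ^ (γ - 1)) * exp (-(t * r)) =
            M * (t ^ (β - 1) * Gamma (1 - β) + t ^ (-γ) * Gamma γ) := by
          have e1 := integral_rpow_mul_exp_neg_mul_Ioi (a := 1 - β) (r := t) (by linarith) ht
          have e2 := integral_rpow_mul_exp_neg_mul_Ioi (a := γ) (r := t) (by linarith) ht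
          rw [one_div, inv_rpow ht.le, ← rpow_neg ht.le] at e1 e2
          rw [show 1 - β - 1 = -β by ring, show -(1 - β) = β - 1 by ring] at e1
          rw [← e1, ← e2, ← integral_add (hi1 t ht) (hi2 t ht), ← integral_const_mul]
          refine integral_congr_ae (Filter.Eventually.of_forall fun r => ?_)
          simp only; ring
        refine (mul_le_mul_of_nonneg_left (h1.trans h2.le) (rpow_pos_of_pos ht _).le).trans ?_
        rw [show β - γ = (1 - γ) + (β - 1) by ring, show 1 - 2 * γ = (1 - γ) + (-γ) by ring,
          rpow_add ht, rpow_add ht]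
        apply le_of_eq; ring
    have hlim : Filter.Tendsto (fun t : ℝ =>
        M * (Gamma (1 - β) * t ^ (β - γ) + Gamma γ * t ^ (1 - 2 * γ)))
        (nhdsWithin 0 (Ici 0)) (nhds 0) := by
      have : Continuous (fun t : ℝ =>
        M * (Gamma (1 - β) * t ^ (β - γ) + Gamma γ * t ^ (1 - 2 * γ))) := by
        have := continuous_rpow_const (q := β - γ) (by linarith)
        have := continuous_rpow_const (q := 1 - 2 * γ) (by linarith)
        fun_prop
      have h := (this.tendsto 0).mono_left (nhdsWithin_le_nhds (s := Ici 0))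
      rwa [zero_rpow (by linarith), zero_rpow (by linarith), mul_zero, mul_zero, add_zero,
        mul_zero] at h
    unfold ContinuousWithinAt
    simp only [le_refl, if_true]
    exact squeeze_zero_norm' (by
      filter_upwards [self_mem_nhdsWithin] with t ht using hb t ht) hlim
  · have hcont : ContinuousAt (fun t => ∫ r in Ioi (0:ℝ), exp (-r * t) * ρ r) t₀ := by
      refine continuousAt_of_dominated (Filter.Eventually.of_forall fun t => ?_) ?_
        (hi (t₀ / 2) (half_pos ht₀)) ?_
      · exact (((by fun_prop : Measurable fun r : ℝ => exp (-r * t))).mul hρ).aestronglyMeasurable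
      · filter_upwards [lt_mem_nhds (half_lt_self ht₀)] with t ht
        filter_upwards [ae_restrict_mem measurableSet_Ioi] with r hr
        refine (hbd t r hr).trans (mul_le_mul_of_nonneg_left ?_
          ((abs_nonneg _).trans (hρb r hr)))
        exact exp_le_exp.2 (by nlinarith [show 0 < r from hr])
      · exact Filter.Eventually.of_forall fun r => by fun_prop
    refine ContinuousAt.continuousWithinAt ?_
    refine ((continuousAt_rpow_const t₀ (1 - γ) (Or.inl ht₀.ne')).mul hcont).congr ?_
    filter_upwards [lt_mem_nhds ht₀] with t ht
    simp [ht.not_ge]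

lemma exists_continuousOn_kernel_factor {μ : ℝ → ℝ} (hμ : IntegrableOn μ (Ioo 0 1))
    (hμ0 : ∀ α ∈ Ioo (0:ℝ) 1, 0 ≤ μ α) {γ : ℝ} (hγ : γ ∈ Ioo (0:ℝ) (1/2))
    (hpos : 0 < ∫ α in Ioo γ (1 - γ), μ α) {S C g : ℝ → ℝ}
    (hS : ∀ r : ℝ, S r = ∫ α in Ioo (0:ℝ) 1, Real.sin (π * α) * r ^ α * μ α)
    (hC : ∀ r : ℝ, C r = ∫ α in Ioo (0:ℝ) 1, Real.cos (π * α) * r ^ α * μ α)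
    (hg : ∀ t : ℝ, 0 < t →
      g t = (1/π) * ∫ r in Ioi (0:ℝ), Real.exp (-r * t) * S r / ((S r)^2 + (C r)^2)) :
    ∃ k : ℝ → ℝ, ContinuousOn k (Ici 0) ∧ ∀ t > 0, g t = t ^ (γ - 1) * k t := by
  obtain ⟨β, hβ, m, hm, hlow⟩ := exists_lower_bound_integral_sin_mul_rpow hμ hμ0 hγ hpos
  have hSm : Measurable S := by
    rw [funext hS]; exact measurable_integral_mul_rpow_mul hμ (by fun_prop)
  have hCm : Measurable C := by
    rw [funext hC]; exact measurable_integral_mul_rpow_mul hμ (by fun_prop)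
  have hρb : ∀ r > 0, |S r / ((S r)^2 + (C r)^2)| ≤ m⁻¹ * (r ^ (-β) + r ^ (γ - 1)) := by
    intro r hr
    have h1 := hlow r hr
    rw [← hS] at h1
    have hmin : 0 < min (r ^ β) (r ^ (1 - γ)) :=
      lt_min (rpow_pos_of_pos hr _) (rpow_pos_of_pos hr _)
    have hSpos : 0 < S r := lt_of_lt_of_le (by positivity) h1
    rw [abs_of_nonneg (by positivity)]
    calc S r / ((S r)^2 + (C r)^2) ≤ S r / (S r) ^ 2 :=
          div_le_div_of_nonneg_left hSpos.le (by positivity) (by nlinarith [sq_nonneg (C r)])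
      _ = (S r)⁻¹ := by field_simp
      _ ≤ (m * min (r ^ β) (r ^ (1 - γ)))⁻¹ := inv_anti₀ (by positivity) h1
      _ = m⁻¹ * (min (r ^ β) (r ^ (1 - γ)))⁻¹ := by rw [mul_inv]
      _ ≤ _ := by
        refine mul_le_mul_of_nonneg_left ?_ (by positivity)
        rw [show γ - 1 = -(1 - γ) by ring, rpow_neg hr.le, rpow_neg hr.le]
        have h2 := rpow_pos_of_pos hr β
        have h3 := rpow_pos_of_pos hr (1 - γ)
        rcases min_choice (r ^ β) (r ^ (1 - γ)) with h | h <;> rw [h]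
        · exact le_add_of_nonneg_right (by positivity)
        · exact le_add_of_nonneg_left (by positivity)
  have hk := continuousOn_rpow_mul_laplace (hSm.div ((hSm.pow_const 2).add (hCm.pow_const 2)))
    hγ.1 hγ.2 hβ.1 (hβ.2.trans (by linarith [hγ.1])) hρb
  refine ⟨_, continuousOn_const (c := 1 / π) |>.mul hk, fun t ht => ?_⟩
  simp only [Pi.mul_apply, Pi.div_apply, Pi.add_apply]
  rw [hg t ht, if_neg ht.not_ge, mul_left_comm, ← mul_assoc (t ^ (γ - 1)), ← rpow_add ht]
  simp [mul_div_assoc]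

section Volterra

variable {E : Type*} [NormedAddCommGroup E] [NormedSpace ℝ E]

lemma intervalIntegrable_rpow_mul_one_sub_rpow {a b : ℝ} (ha : 0 < a) (hb : 0 < b) :
    IntervalIntegrable (fun x : ℝ => x ^ (a - 1) * (1 - x) ^ (b - 1)) volume 0 1 := by
  have h := (Complex.betaIntegral_convergent (u := a) (v := b) (by simpa) (by simpa)).norm
  rw [intervalIntegrable_iff_integrableOn_Ioo_of_le zero_le_one] at h ⊢
  refine h.congr_fun (fun x hx => ?_) measurableSet_Ioo
  have h1 : 0 < 1 - x := by linarith [hx.2]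
  simp only [norm_mul]
  rw [Complex.norm_cpow_eq_rpow_re_of_pos hx.1,
    show (1 : ℂ) - x = ((1 - x : ℝ) : ℂ) by push_cast; rfl,
    Complex.norm_cpow_eq_rpow_re_of_pos h1]
  simp

lemma rpow_mul_exp_neg_le_one {y δ : ℝ} (hy : 0 ≤ y) (hδ0 : 0 ≤ δ) (hδ : δ ≤ 1) :
    y ^ δ * exp (-y) ≤ 1 := by
  have h : y ^ δ ≤ exp y := by
    rcases le_total y 1 with h | h
    · exact (rpow_le_one hy h hδ0).trans (one_le_exp hy)
    · calc y ^ δ ≤ y ^ (1:ℝ) := rpow_le_rpow_of_exponent_le h hδ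
        _ = y := rpow_one y
        _ ≤ exp y := by linarith [add_one_le_exp y]
  rw [exp_neg]
  exact mul_inv_le_one_of_le₀ h (exp_pos _).le

lemma exp_neg_mul_le_rpow {s l δ : ℝ} (hs : 0 < s) (hl : 0 < l) (hδ0 : 0 ≤ δ) (hδ : δ ≤ 1) :
    exp (-(l * s)) ≤ l ^ (-δ) * s ^ (-δ) := by
  have h := rpow_mul_exp_neg_le_one (mul_pos hl hs).le hδ0 hδ
  rw [← mul_rpow hl.le hs.le, rpow_neg (by positivity)]
  rw [← one_div, le_div_iff₀' (by positivity)]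
  exact h

lemma exists_rpow_neg_mul_lt_one (X : ℝ) {δ : ℝ} (hδ : 0 < δ) :
    ∃ l > 0, X * l ^ (-δ) < 1 := by
  have h := (tendsto_rpow_neg_atTop hδ).const_mul X
  rw [mul_zero] at h
  obtain ⟨l, h1, h2⟩ := ((h.eventually (gt_mem_nhds one_pos)).and
    (Filter.eventually_gt_atTop 0)).exists
  exact ⟨l, h2, h1⟩

/-- The weighted convolution `t^{1-γ} ∫₀ᵗ g(t-s) s^{γ-1} u(s) ds` with kernel
`g(t) = t^{γ-1} k(t)`, written over the unit interval. -/
noncomputable def singConv (γ : ℝ) (k : ℝ → ℝ) (u : ℝ → E) (t : ℝ) : E :=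
  t ^ γ • ∫ x in (0:ℝ)..1, (x ^ (γ - 1) * (1 - x) ^ (γ - 1) * k (t * x)) • u (t * (1 - x))

lemma aestronglyMeasurable_singConv_integrand (γ : ℝ) {k : ℝ → ℝ} {u : ℝ → E} (hk : Continuous k)
    (hu : Continuous u) (t : ℝ) (ν : Measure ℝ) :
    AEStronglyMeasurable
      (fun x => (x ^ (γ - 1) * (1 - x) ^ (γ - 1) * k (t * x)) • u (t * (1 - x))) ν := by
  have h1 : Measurable fun x => x ^ (γ - 1) * (1 - x) ^ (γ - 1) * k (t * x) := by
    have := hk.measurable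
    fun_prop
  exact h1.aestronglyMeasurable.smul (by fun_prop : Continuous fun x => u (t * (1 - x))).aestronglyMeasurable

lemma norm_singConv_integrand_le {γ T M U : ℝ} {k : ℝ → ℝ} {u : ℝ → E}
    (hM : ∀ t ∈ Icc 0 T, |k t| ≤ M) (hU : ∀ t ∈ Icc 0 T, ‖u t‖ ≤ U) {t : ℝ} (ht : t ∈ Icc 0 T)
    {x : ℝ} (hx : x ∈ Ioc (0:ℝ) 1) :
    ‖(x ^ (γ - 1) * (1 - x) ^ (γ - 1) * k (t * x)) • u (t * (1 - x))‖ ≤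
      x ^ (γ - 1) * (1 - x) ^ (γ - 1) * (M * U) := by
  have hx1 : 0 ≤ 1 - x := by linarith [hx.2]
  have hx0 := hx.1
  have h1 := hM (t * x) ⟨mul_nonneg ht.1 hx.1.le, by nlinarith [ht.1, ht.2]⟩
  have h2 := hU (t * (1 - x)) ⟨mul_nonneg ht.1 hx1, by nlinarith [ht.1, ht.2]⟩
  have h3 : 0 ≤ x ^ (γ - 1) * (1 - x) ^ (γ - 1) := by positivity
  rw [norm_smul, norm_mul, norm_of_nonneg h3, mul_assoc]
  exact mul_le_mul_of_nonneg_left (mul_le_mul h1 h2 (norm_nonneg _) ((abs_nonneg _).trans h1)) h3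

lemma exists_norm_le_Icc {V : Type*} [NormedAddCommGroup V] {u : ℝ → V} {T : ℝ}
    (hu : ContinuousOn u (Icc 0 T)) :
    ∃ U, ∀ t ∈ Icc 0 T, ‖u t‖ ≤ U := isCompact_Icc.exists_bound_of_continuousOn hu

lemma intervalIntegrable_singConv_integrand {γ T : ℝ} (hγ : 0 < γ) {k : ℝ → ℝ} {u : ℝ → E}
    (hk : Continuous k) (hu : Continuous u) {t : ℝ} (ht : t ∈ Icc 0 T) :
    IntervalIntegrable (fun x => (x ^ (γ - 1) * (1 - x) ^ (γ - 1) * k (t * x)) • u (t * (1 - x)))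
      volume 0 1 := by
  obtain ⟨M, hM⟩ := exists_norm_le_Icc (T := T) hk.continuousOn
  obtain ⟨U, hU⟩ := exists_norm_le_Icc (T := T) hu.continuousOn
  refine ((intervalIntegrable_rpow_mul_one_sub_rpow hγ hγ).mul_const (M * U)).mono_fun'
    (aestronglyMeasurable_singConv_integrand γ hk hu t _) ?_
  rw [uIoc_of_le zero_le_one]
  filter_upwards [ae_restrict_mem measurableSet_Ioc] with x hx
  exact norm_singConv_integrand_le hM hU ht hx

lemma continuous_singConv {γ T : ℝ} (hγ : 0 < γ) {k : ℝ → ℝ} {u : ℝ → E}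
    (hk : Continuous k) (hu : Continuous u) :
    Continuous fun t : Icc (0:ℝ) T => singConv γ k u t := by
  obtain ⟨M, hM⟩ := exists_norm_le_Icc (T := T) hk.continuousOn
  obtain ⟨U, hU⟩ := exists_norm_le_Icc (T := T) hu.continuousOn
  refine ((continuous_rpow_const hγ.le).comp continuous_subtype_val).smul ?_
  refine intervalIntegral.continuous_of_dominated_interval
    (bound := fun x => x ^ (γ - 1) * (1 - x) ^ (γ - 1) * (M * U)) (fun t => ?_) (fun t => ?_)
    ((intervalIntegrable_rpow_mul_one_sub_rpow hγ hγ).mul_const _) ?_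
  · exact aestronglyMeasurable_singConv_integrand γ hk hu t _
  · rw [uIoc_of_le zero_le_one]
    exact Filter.Eventually.of_forall fun x hx => norm_singConv_integrand_le hM hU t.2 hx
  · refine Filter.Eventually.of_forall fun x _ => ?_
    fun_prop

lemma singConv_sub {γ T : ℝ} (hγ : 0 < γ) {k : ℝ → ℝ} {u v : ℝ → E}
    (hk : Continuous k) (hu : Continuous u) (hv : Continuous v) {t : ℝ} (ht : t ∈ Icc 0 T) :
    singConv γ k u t - singConv γ k v t = singConv γ k (fun s => u s - v s) t := by
  simp only [singConv, smul_sub]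
  rw [intervalIntegral.integral_sub (intervalIntegrable_singConv_integrand hγ hk hu ht)
    (intervalIntegrable_singConv_integrand hγ hk hv ht), smul_sub]

lemma norm_singConv_le {γ T M D l : ℝ} (hγ : 0 < γ) (hγ1 : γ < 1) (hl : 0 < l) {k : ℝ → ℝ}
    {u : ℝ → E} (hM : ∀ t ∈ Icc 0 T, |k t| ≤ M)
    (hD : 0 ≤ D) (hU : ∀ t ∈ Icc 0 T, ‖u t‖ ≤ D * exp (l * t)) {t : ℝ} (ht : t ∈ Icc 0 T) :
    ‖singConv γ k u t‖ ≤ exp (l * t) * (M * D * T ^ (γ / 2) * l ^ (-(γ / 2)) *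
      ∫ x in (0:ℝ)..1, x ^ (γ / 2 - 1) * (1 - x) ^ (γ - 1)) := by
  have hM0 : 0 ≤ M := (abs_nonneg _).trans (hM t ht)
  have hB : 0 ≤ ∫ x in (0:ℝ)..1, x ^ (γ / 2 - 1) * (1 - x) ^ (γ - 1) := by
    refine intervalIntegral.integral_nonneg zero_le_one fun x hx => ?_
    have := hx.1
    have : 0 ≤ 1 - x := by linarith [hx.2]
    positivity
  rcases eq_or_lt_of_le ht.1 with rfl | ht0
  · have hT : 0 ≤ T := ht.2
    rw [singConv, zero_rpow hγ.ne', zero_smul, norm_zero]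
    positivity
  have hT : 0 < T := ht0.trans_le ht.2
  set c := M * D * (exp (l * t) * (l ^ (-(γ / 2)) * t ^ (-(γ / 2)))) with hc
  have key : ‖∫ x in (0:ℝ)..1, (x ^ (γ - 1) * (1 - x) ^ (γ - 1) * k (t * x)) • u (t * (1 - x))‖ ≤
      ∫ x in (0:ℝ)..1, c * (x ^ (γ / 2 - 1) * (1 - x) ^ (γ - 1)) := by
    refine intervalIntegral.norm_integral_le_of_norm_le zero_le_one
      (Filter.Eventually.of_forall fun x hx => ?_)
      ((intervalIntegrable_rpow_mul_one_sub_rpow (half_pos hγ) hγ).const_mul c)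
    have hx1 : 0 ≤ 1 - x := by linarith [hx.2]
    have hx0 := hx.1
    have h1 := hM (t * x) ⟨by positivity, by nlinarith [ht.1, ht.2, hx.2]⟩
    have h2 := hU (t * (1 - x)) ⟨by positivity, by nlinarith [ht.1, ht.2]⟩
    have h3 : 0 ≤ x ^ (γ - 1) * (1 - x) ^ (γ - 1) := by positivity
    rw [norm_smul, norm_mul, norm_of_nonneg h3]
    have h4 : exp (l * (t * (1 - x))) ≤
        exp (l * t) * (l ^ (-(γ / 2)) * (t ^ (-(γ / 2)) * x ^ (-(γ / 2)))) := by
      rw [show l * (t * (1 - x)) = l * t + -(l * (t * x)) by ring, exp_add,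
        ← mul_rpow ht0.le hx0.le]
      exact mul_le_mul_of_nonneg_left (exp_neg_mul_le_rpow (by positivity) hl (by positivity)
        (by linarith)) (exp_pos _).le
    calc _ ≤ x ^ (γ - 1) * (1 - x) ^ (γ - 1) * M * (D *
        (exp (l * t) * (l ^ (-(γ / 2)) * (t ^ (-(γ / 2)) * x ^ (-(γ / 2)))))) := by
          refine mul_le_mul (mul_le_mul_of_nonneg_left h1 h3)
            (h2.trans (mul_le_mul_of_nonneg_left h4 hD)) (norm_nonneg _) (by positivity)
      _ = _ := by
          rw [hc, show γ / 2 - 1 = (γ - 1) + -(γ / 2) by ring, rpow_add hx0]; ring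
  rw [intervalIntegral.integral_const_mul] at key
  rw [singConv, norm_smul, norm_of_nonneg (by positivity)]
  refine (mul_le_mul_of_nonneg_left key (by positivity)).trans ?_
  have h5 : t ^ γ * t ^ (-(γ / 2)) ≤ T ^ (γ / 2) := by
    rw [← rpow_add ht0, show γ + -(γ / 2) = γ / 2 by ring]
    exact rpow_le_rpow ht0.le ht.2 (by positivity)
  calc _ = (t ^ γ * t ^ (-(γ / 2))) * (exp (l * t) * (M * D * l ^ (-(γ / 2)) *
      ∫ x in (0:ℝ)..1, x ^ (γ / 2 - 1) * (1 - x) ^ (γ - 1))) := by rw [hc]; ring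
    _ ≤ T ^ (γ / 2) * (exp (l * t) * (M * D * l ^ (-(γ / 2)) *
      ∫ x in (0:ℝ)..1, x ^ (γ / 2 - 1) * (1 - x) ^ (γ - 1))) :=
        mul_le_mul_of_nonneg_right h5 (by positivity)
    _ = _ := by ring

lemma rpow_smul_singConv {γ : ℝ} (k : ℝ → ℝ) (u : ℝ → E) {t : ℝ} (ht : 0 < t) :
    t ^ (γ - 1) • singConv γ k u t =
      ∫ s in (0:ℝ)..t, (s ^ (γ - 1) * k s) • ((t - s) ^ (γ - 1) • u (t - s)) := by
  have h := intervalIntegral.smul_integral_comp_mul_left (a := 0) (b := 1)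
    (fun s => (s ^ (γ - 1) * k s) • ((t - s) ^ (γ - 1) • u (t - s))) t
  rw [mul_zero, mul_one] at h
  rw [← h, singConv, smul_smul, ← rpow_add ht, ← intervalIntegral.integral_smul,
    ← intervalIntegral.integral_smul]
  refine intervalIntegral.integral_congr_ae (Filter.Eventually.of_forall fun x hx => ?_)
  rw [uIoc_of_le zero_le_one] at hx
  have hx1 : 0 ≤ 1 - x := by linarith [hx.2]
  rw [show t - t * x = t * (1 - x) by ring, mul_rpow ht.le hx.1.le, mul_rpow ht.le hx1,
    smul_smul, smul_smul, smul_smul]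
  congr 1
  rw [show γ - 1 + γ = 1 + (γ - 1) + (γ - 1) by ring, rpow_add ht, rpow_add ht, rpow_one]
  ring

lemma integral_integral_smul_sub {g : ℝ → ℝ} {φ : ℝ → E} {t : ℝ} (ht : 0 ≤ t)
    (hg : IntervalIntegrable g volume 0 t) (hφ : IntervalIntegrable φ volume 0 t) :
    ∫ s in (0:ℝ)..t, ∫ σ in (0:ℝ)..s, g σ • φ (s - σ) =
      ∫ σ in (0:ℝ)..t, g σ • ∫ s in (0:ℝ)..(t - σ), φ s := by
  rw [intervalIntegrable_iff_integrableOn_Ioo_of_le ht] at hg hφ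
  have hprod := (((integrable_indicator_iff measurableSet_Ioo).2 hg).convolution_integrand
    (ContinuousLinearMap.lsmul ℝ ℝ : ℝ →L[ℝ] E →L[ℝ] E)
    ((integrable_indicator_iff measurableSet_Ioo).2 hφ))
  have hswap := integral_integral_swap (μ := volume.restrict (Ioo 0 t)) (ν := volume)
    (f := fun s σ => (Ioo 0 t).indicator g σ • (Ioo 0 t).indicator φ (s - σ)) (by
      have h := hprod.mono_measure
        (Measure.prod_mono (Measure.restrict_le_self (s := Ioo 0 t)) (le_refl (volume : Measure ℝ)))
      exact h)
  rw [intervalIntegral.integral_of_le ht, intervalIntegral.integral_of_le ht,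
    integral_Ioc_eq_integral_Ioo, integral_Ioc_eq_integral_Ioo]
  have hl : ∀ s ∈ Ioo 0 t, ∫ σ in (0:ℝ)..s, g σ • φ (s - σ) =
      ∫ σ, (Ioo 0 t).indicator g σ • (Ioo 0 t).indicator φ (s - σ) := by
    intro s hs
    rw [intervalIntegral.integral_of_le hs.1.le, integral_Ioc_eq_integral_Ioo,
      ← integral_indicator measurableSet_Ioo]
    congr 1
    funext σ
    by_cases h : σ ∈ Ioo 0 s
    · rw [indicator_of_mem h, indicator_of_mem (show σ ∈ Ioo 0 t from ⟨h.1, h.2.trans hs.2⟩),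
        indicator_of_mem (show s - σ ∈ Ioo 0 t from ⟨by linarith [h.2], by linarith [h.1, hs.2]⟩)]
    · rw [indicator_of_notMem h]
      by_cases h0 : 0 < σ
      · rw [indicator_of_notMem (s := Ioo 0 t) (f := φ) (fun h1 => h ⟨h0, by linarith [h1.1]⟩),
          smul_zero]
      · rw [indicator_of_notMem (s := Ioo 0 t) (f := g) (fun h1 => h0 h1.1), zero_smul]
  rw [setIntegral_congr_fun measurableSet_Ioo hl, hswap, ← integral_indicator measurableSet_Ioo]
  congr 1
  funext σ
  rw [integral_smul]
  by_cases h : σ ∈ Ioo 0 t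
  · rw [indicator_of_mem h, indicator_of_mem h]
    congr 1
    rw [← integral_Ioc_eq_integral_Ioo, ← intervalIntegral.integral_of_le ht,
      intervalIntegral.integral_comp_sub_right (fun s => (Ioo 0 t).indicator φ s),
      intervalIntegral.integral_of_le (by linarith), setIntegral_indicator measurableSet_Ioo,
      intervalIntegral.integral_of_le (by linarith [h.2])]
    congr 2
    ext s
    simp only [mem_inter_iff, mem_Ioc, mem_Ioo]
    have := h.1
    constructor
    · rintro ⟨⟨_, h2⟩, h3, _⟩; exact ⟨h3, h2⟩
    · rintro ⟨h1, h2⟩; exact ⟨⟨by linarith, h2⟩, h1, by linarith⟩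
  · rw [indicator_of_notMem h, indicator_of_notMem h, zero_smul]

lemma intervalIntegrable_rpow_smul {γ : ℝ} (hγ : 0 < γ) {w : ℝ → E} (hw : Continuous w)
    (a b : ℝ) : IntervalIntegrable (fun s => s ^ (γ - 1) • w s) volume a b :=
  (intervalIntegral.intervalIntegrable_rpow' (by linarith)).smul_continuousOn hw.continuousOn

lemma continuous_primitive_rpow_smul {γ : ℝ} (hγ : 0 < γ) {w : ℝ → E} (hw : Continuous w) :
    Continuous fun t => ∫ s in (0:ℝ)..t, s ^ (γ - 1) • w s :=
  intervalIntegral.continuous_primitive (intervalIntegrable_rpow_smul hγ hw) 0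

lemma hasDerivAt_primitive_rpow_smul [CompleteSpace E] {γ : ℝ} (hγ : 0 < γ) {w : ℝ → E}
    (hw : Continuous w) {t : ℝ} (ht : 0 < t) :
    HasDerivAt (fun t => ∫ s in (0:ℝ)..t, s ^ (γ - 1) • w s) (t ^ (γ - 1) • w t) t := by
  refine intervalIntegral.integral_hasDerivAt_right (intervalIntegrable_rpow_smul hγ hw _ _) ?_ ?_
  · exact ((by fun_prop : Measurable fun s : ℝ => s ^ (γ - 1)).stronglyMeasurable.smul
      hw.stronglyMeasurable).aestronglyMeasurable.stronglyMeasurableAtFilter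
  · exact (continuousAt_rpow_const t _ (Or.inl ht.ne')).smul hw.continuousAt

lemma norm_primitive_rpow_smul_le {γ T D l : ℝ} (hγ : 0 < γ) (hl : 0 < l) (hD : 0 ≤ D)
    {w : ℝ → E} (hw : ∀ s ∈ Icc 0 T, ‖w s‖ ≤ D * exp (l * s)) {t : ℝ} (ht : t ∈ Icc 0 T) :
    ‖∫ s in (0:ℝ)..t, s ^ (γ - 1) • w s‖ ≤ t ^ γ / γ * (D * exp (l * t)) := by
  calc _ ≤ ∫ s in (0:ℝ)..t, s ^ (γ - 1) * (D * exp (l * t)) := by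
        refine intervalIntegral.norm_integral_le_of_norm_le ht.1
          (Filter.Eventually.of_forall fun s hs => ?_)
          ((intervalIntegral.intervalIntegrable_rpow' (by linarith)).mul_const _)
        rw [norm_smul, norm_of_nonneg (rpow_nonneg hs.1.le _)]
        refine mul_le_mul_of_nonneg_left ((hw s ⟨hs.1.le, hs.2.trans ht.2⟩).trans ?_)
          (rpow_nonneg hs.1.le _)
        exact mul_le_mul_of_nonneg_left (exp_le_exp.2 (by nlinarith [hs.2])) hD
    _ = _ := by
        rw [intervalIntegral.integral_mul_const, integral_rpow (Or.inl (by linarith)),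
          sub_add_cancel, zero_rpow hγ.ne', sub_zero]

/-- For `c(t) = c₀ + ∫₀ᵗ s^{γ-1} w(s) ds`, this is `t^{1-γ}` times the derivative of
`F - A c`, where `A'` and `F'` are the derivatives of `A` and `F`. -/
noncomputable def weightedDeriv (γ : ℝ) (A A' : ℝ → E →L[ℝ] E) (F' : ℝ → E) (c₀ : E)
    (w : ℝ → E) (t : ℝ) : E :=
  t ^ (1 - γ) • (F' t - A' t (c₀ + ∫ s in (0:ℝ)..t, s ^ (γ - 1) • w s)) - A t (w t)

lemma continuous_weightedDeriv {γ : ℝ} (hγ : 0 < γ) (hγ1 : γ < 1) {A A' : ℝ → E →L[ℝ] E}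
    {F' : ℝ → E} (hA : Continuous A) (hA' : Continuous A') (hF' : Continuous F') (c₀ : E)
    {w : ℝ → E} (hw : Continuous w) : Continuous (weightedDeriv γ A A' F' c₀ w) := by
  have h1 := continuous_primitive_rpow_smul hγ hw
  have h2 : Continuous fun t : ℝ => t ^ (1 - γ) := continuous_rpow_const (by linarith)
  exact (h2.smul (hF'.sub (hA'.clm_apply (continuous_const.add h1)))).sub (hA.clm_apply hw)

lemma norm_weightedDeriv_sub_le {γ T L L' D l : ℝ} (hγ : 0 < γ) (hγ1 : γ < 1) (hl : 0 < l)
    (hD : 0 ≤ D) {A A' : ℝ → E →L[ℝ] E} (F' : ℝ → E) (c₀ : E)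
    (hL : ∀ t ∈ Icc 0 T, ‖A t‖ ≤ L) (hL' : ∀ t ∈ Icc 0 T, ‖A' t‖ ≤ L')
    {w v : ℝ → E} (hw : Continuous w) (hv : Continuous v)
    (hwv : ∀ s ∈ Icc 0 T, ‖w s - v s‖ ≤ D * exp (l * s)) {t : ℝ} (ht : t ∈ Icc 0 T) :
    ‖weightedDeriv γ A A' F' c₀ w t - weightedDeriv γ A A' F' c₀ v t‖ ≤
      (L' * (T / γ) + L) * D * exp (l * t) := by
  have hJ : (∫ s in (0:ℝ)..t, s ^ (γ - 1) • w s) - (∫ s in (0:ℝ)..t, s ^ (γ - 1) • v s) =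
      ∫ s in (0:ℝ)..t, s ^ (γ - 1) • (w s - v s) := by
    rw [← intervalIntegral.integral_sub (intervalIntegrable_rpow_smul hγ hw _ _)
      (intervalIntegrable_rpow_smul hγ hv _ _)]
    simp only [smul_sub]
  have heq : weightedDeriv γ A A' F' c₀ w t - weightedDeriv γ A A' F' c₀ v t =
      -(t ^ (1 - γ) • A' t (∫ s in (0:ℝ)..t, s ^ (γ - 1) • (w s - v s))) - A t (w t - v t) := by
    rw [← hJ]
    simp only [weightedDeriv, map_add, map_sub, smul_sub, smul_add]
    abel
  have hLt := hL t ht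
  have hLt' := hL' t ht
  have hL0 := (norm_nonneg _).trans hLt
  have hL0' := (norm_nonneg _).trans hLt'
  have ht0 := ht.1
  have hJb := norm_primitive_rpow_smul_le hγ hl hD hwv ht
  have h1 : ‖t ^ (1 - γ) • A' t (∫ s in (0:ℝ)..t, s ^ (γ - 1) • (w s - v s))‖ ≤
      L' * (T / γ) * (D * exp (l * t)) := by
    rw [norm_smul, norm_of_nonneg (by positivity)]
    have h2 : t ^ (1 - γ) * t ^ γ = t := by
      rw [← rpow_add_of_nonneg ht0 (by linarith) hγ.le, sub_add_cancel, rpow_one]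
    calc _ ≤ t ^ (1 - γ) * (L' * (t ^ γ / γ * (D * exp (l * t)))) := by
          refine mul_le_mul_of_nonneg_left ?_ (by positivity)
          exact ((A' t).le_opNorm _).trans (mul_le_mul hLt' hJb (norm_nonneg _) hL0')
      _ = L' * ((t ^ (1 - γ) * t ^ γ) / γ) * (D * exp (l * t)) := by ring
      _ ≤ _ := by
          rw [h2]
          have := ht.2
          gcongr
  have h3 : ‖A t (w t - v t)‖ ≤ L * (D * exp (l * t)) :=
    ((A t).le_opNorm _).trans (mul_le_mul hLt (hwv t ht) (norm_nonneg _) hL0)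
  rw [heq]
  refine (norm_sub_le _ _).trans ?_
  rw [norm_neg]
  linarith

lemma exists_fixedPoint_singConv [CompleteSpace E] {γ T : ℝ} (hγ : 0 < γ) (hγ1 : γ < 1)
    (hT : 0 < T) {k : ℝ → ℝ} (hk : Continuous k) {A A' : ℝ → E →L[ℝ] E}
    {F' : ℝ → E} (hA : Continuous A) (hA' : Continuous A') (hF' : Continuous F') (c₀ f₀ : E) :
    ∃ w : ℝ → E, Continuous w ∧ ∀ t ∈ Icc 0 T,
      w t = k t • f₀ + singConv γ k (weightedDeriv γ A A' F' c₀ w) t := by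
  obtain ⟨M, hM⟩ := exists_norm_le_Icc (T := T) hk.continuousOn
  obtain ⟨L, hL⟩ := exists_norm_le_Icc (T := T) hA.continuousOn
  obtain ⟨L', hL'⟩ := exists_norm_le_Icc (T := T) hA'.continuousOn
  have h0T : (0:ℝ) ∈ Icc 0 T := ⟨le_rfl, hT.le⟩
  have hL0 := (norm_nonneg _).trans (hL 0 h0T)
  have hL0' := (norm_nonneg _).trans (hL' 0 h0T)
  set B := ∫ x in (0:ℝ)..1, x ^ (γ / 2 - 1) * (1 - x) ^ (γ - 1)
  obtain ⟨l, hl, hq⟩ := exists_rpow_neg_mul_lt_one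
    (M * (L' * (T / γ) + L) * T ^ (γ / 2) * B) (half_pos hγ)
  set q := M * (L' * (T / γ) + L) * T ^ (γ / 2) * B * l ^ (-(γ / 2)) with hqdef
  let W : C(Icc (0:ℝ) T, E) → ℝ → E := fun z t => exp (l * t) • IccExtend hT.le z t
  have hW : ∀ z, Continuous (W z) := fun z =>
    (by fun_prop : Continuous fun t : ℝ => exp (l * t)).smul z.continuous.Icc_extend'
  have hD := fun z => continuous_weightedDeriv hγ hγ1 hA hA' hF' c₀ (hW z)
  let Φ : C(Icc (0:ℝ) T, E) → C(Icc (0:ℝ) T, E) := fun z =>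
    ⟨fun t => exp (-(l * t)) • (k t • f₀ + singConv γ k (weightedDeriv γ A A' F' c₀ (W z)) t), by
      have h1 := continuous_singConv (T := T) hγ hk (hD z)
      have h2 : Continuous fun t : Icc (0:ℝ) T => k t := hk.comp continuous_subtype_val
      exact (by fun_prop : Continuous fun t : Icc (0:ℝ) T => exp (-(l * t))).smul
        ((h2.smul continuous_const).add h1)⟩
  have hlip : ∀ z z', dist (Φ z) (Φ z') ≤ q.toNNReal * dist z z' := by
    intro z z'
    rw [ContinuousMap.dist_le (by positivity)]
    intro t
    have hdiff : ∀ s ∈ Icc 0 T, ‖W z s - W z' s‖ ≤ dist z z' * exp (l * s) := by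
      intro s hs
      rw [← smul_sub, norm_smul, norm_of_nonneg (exp_pos _).le, mul_comm, ← dist_eq_norm]
      exact mul_le_mul_of_nonneg_right (ContinuousMap.dist_apply_le_dist _) (exp_pos _).le
    have hb := norm_singConv_le hγ hγ1 hl hM (D := (L' * (T / γ) + L) * dist z z') (by positivity)
      (fun s hs => norm_weightedDeriv_sub_le hγ hγ1 hl dist_nonneg F' c₀ hL hL' (hW z) (hW z')
        hdiff hs) t.2
    have he : Φ z t - Φ z' t = exp (-(l * t)) • singConv γ k (fun s =>
        weightedDeriv γ A A' F' c₀ (W z) s - weightedDeriv γ A A' F' c₀ (W z') s) t := by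
      rw [← singConv_sub hγ hk (hD z) (hD z') t.2]
      simp only [Φ, ContinuousMap.coe_mk]
      rw [← smul_sub, add_sub_add_left_eq_sub]
    rw [dist_eq_norm, he, norm_smul, norm_of_nonneg (exp_pos _).le]
    calc _ ≤ exp (-(l * t)) * (exp (l * t) * (M * ((L' * (T / γ) + L) * dist z z') * T ^ (γ / 2) *
          l ^ (-(γ / 2)) * B)) := mul_le_mul_of_nonneg_left hb (exp_pos _).le
      _ = q * dist z z' := by
          rw [← mul_assoc, ← exp_add, neg_add_cancel, exp_zero, one_mul, hqdef]; ring
      _ ≤ _ := mul_le_mul_of_nonneg_right (le_coe_toNNReal q) dist_nonneg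
  have hcontr : ContractingWith q.toNNReal Φ :=
    ⟨by rw [← NNReal.coe_lt_coe, coe_toNNReal', NNReal.coe_one]; exact max_lt hq one_pos,
      LipschitzWith.of_dist_le_mul hlip⟩
  set z := hcontr.fixedPoint Φ
  have hz : Φ z = z := hcontr.fixedPoint_isFixedPt
  refine ⟨W z, hW z, fun t ht => ?_⟩
  have h1 : z ⟨t, ht⟩ = exp (-(l * t)) •
      (k t • f₀ + singConv γ k (weightedDeriv γ A A' F' c₀ (W z)) t) := by
    conv_lhs => rw [← hz]
    rfl
  have h2 : W z t = exp (l * t) • z ⟨t, ht⟩ := by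
    simp only [W]; rw [IccExtend_of_mem _ _ ht]
  rw [h2, h1, smul_smul, ← exp_add, add_neg_cancel, exp_zero, one_smul]

lemma exists_volterra_sol [CompleteSpace E] {γ T : ℝ} (hγ : 0 < γ) (hγ1 : γ < 1)
    (hT : 0 < T) {k g : ℝ → ℝ} (hk : Continuous k) (hg : ∀ t ∈ Ioc 0 T, g t = t ^ (γ - 1) * k t)
    {A A' : ℝ → E →L[ℝ] E} {F F' : ℝ → E} (hA : Continuous A) (hA' : Continuous A')
    (hF : Continuous F) (hF' : Continuous F') (hAd : ∀ t ∈ Ioo 0 T, HasDerivAt A (A' t) t)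
    (hFd : ∀ t ∈ Ioo 0 T, HasDerivAt F (F' t) t) (c₀ : E) :
    ∃ w : ℝ → E, Continuous w ∧ ∀ t ∈ Icc 0 T,
      c₀ + (∫ s in (0:ℝ)..t, s ^ (γ - 1) • w s) = c₀ + ∫ s in (0:ℝ)..t,
        g (t - s) • (F s - A s (c₀ + ∫ s in (0:ℝ)..s, s ^ (γ - 1) • w s)) := by
  obtain ⟨w, hw, hfix⟩ := exists_fixedPoint_singConv hγ hγ1 hT hk hA hA' hF' c₀ (F 0 - A 0 c₀)
  refine ⟨w, hw, fun t ht => ?_⟩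
  set c : ℝ → E := fun t => c₀ + ∫ s in (0:ℝ)..t, s ^ (γ - 1) • w s with hc
  set u := weightedDeriv γ A A' F' c₀ w
  have hu : Continuous u := continuous_weightedDeriv hγ hγ1 hA hA' hF' c₀ hw
  have hcc : Continuous c := continuous_const.add (continuous_primitive_rpow_smul hγ hw)
  have hc0 : c 0 = c₀ := by simp [hc]
  have hf : ∀ s ∈ Icc 0 T, F s - A s (c s) = (F 0 - A 0 c₀) + ∫ r in (0:ℝ)..s, r ^ (γ - 1) • u r := by
    intro s hs
    have h := intervalIntegral.integral_eq_sub_of_hasDerivAt_of_le hs.1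
      (f := fun r => F r - A r (c r)) (f' := fun r => r ^ (γ - 1) • u r)
      (hF.sub (hA.clm_apply hcc)).continuousOn (fun r hr => ?_)
      (intervalIntegrable_rpow_smul hγ hu _ _)
    · rw [h, hc0]; abel
    · have hr' : r ∈ Ioo 0 T := ⟨hr.1, hr.2.trans_le hs.2⟩
      refine ((hFd r hr').sub ((hAd r hr').clm_apply ((hasDerivAt_primitive_rpow_smul hγ hw hr.1).const_add c₀))).congr_deriv ?_
      simp only [u, weightedDeriv]
      rw [smul_sub, smul_smul, ← rpow_add hr.1, map_smul]
      simp
      abel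
  have hgi : IntervalIntegrable g volume 0 t := by
    refine IntervalIntegrable.congr (f := fun s => s ^ (γ - 1) • k s) ?_
      (intervalIntegrable_rpow_smul hγ hk 0 t)
    intro s hs
    rw [uIoc_of_le ht.1] at hs
    exact (hg s ⟨hs.1, hs.2.trans ht.2⟩).symm
  have hφi := intervalIntegrable_rpow_smul hγ hu 0 t
  have hconv := integral_integral_smul_sub ht.1 hgi hφi
  have hv : ∀ s ∈ Ioc 0 t, s ^ (γ - 1) • w s = g s • (F 0 - A 0 c₀) +
      ∫ σ in (0:ℝ)..s, g σ • ((s - σ) ^ (γ - 1) • u (s - σ)) := by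
    intro s hs
    have hsT : s ∈ Ioc 0 T := ⟨hs.1, hs.2.trans ht.2⟩
    rw [hfix s ⟨hs.1.le, hsT.2⟩, smul_add, rpow_smul_singConv k u hs.1, smul_smul, ← hg s hsT]
    congr 1
    refine intervalIntegral.integral_congr_ae (Filter.Eventually.of_forall fun σ hσ => ?_)
    rw [uIoc_of_le hs.1.le] at hσ
    rw [hg σ ⟨hσ.1, hσ.2.trans hsT.2⟩]
  have hgf : IntervalIntegrable (fun s => g s • (F 0 - A 0 c₀)) volume 0 t :=
    hgi.smul_continuousOn continuousOn_const
  congr 1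
  have hI : IntervalIntegrable
      (fun s => ∫ σ in (0:ℝ)..s, g σ • ((s - σ) ^ (γ - 1) • u (s - σ))) volume 0 t := by
    refine ((intervalIntegrable_rpow_smul hγ hw 0 t).sub hgf).congr fun s hs => ?_
    rw [uIoc_of_le ht.1] at hs
    simp only [hv s hs, add_sub_cancel_left]
  have hgΦ : IntervalIntegrable
      (fun σ => g σ • ∫ s in (0:ℝ)..(t - σ), s ^ (γ - 1) • u s) volume 0 t :=
    hgi.smul_continuousOn ((continuous_primitive_rpow_smul hγ hu).comp
      (continuous_const.sub continuous_id)).continuousOn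
  have hleft : ∫ s in (0:ℝ)..t, s ^ (γ - 1) • w s = (∫ s in (0:ℝ)..t, g s • (F 0 - A 0 c₀)) +
      ∫ σ in (0:ℝ)..t, g σ • ∫ s in (0:ℝ)..(t - σ), s ^ (γ - 1) • u s := by
    rw [← hconv, ← intervalIntegral.integral_add hgf hI]
    refine intervalIntegral.integral_congr_ae (Filter.Eventually.of_forall fun s hs => ?_)
    rw [uIoc_of_le ht.1] at hs
    exact hv s hs
  have hright := intervalIntegral.integral_comp_sub_left (a := 0) (b := t)
    (fun s => g s • (F (t - s) - A (t - s) (c (t - s)))) t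
  simp only [sub_sub_cancel, sub_self, sub_zero] at hright
  refine (hleft.trans ?_).trans hright.symm
  rw [← intervalIntegral.integral_add hgf hgΦ]
  refine intervalIntegral.integral_congr_ae (Filter.Eventually.of_forall fun s hs => ?_)
  rw [uIoc_of_le ht.1] at hs
  rw [hf (t - s) ⟨by linarith [hs.2], by linarith [hs.1, ht.2]⟩, smul_add]

lemma eq_zero_of_volterra_homogeneous {γ T : ℝ} (hγ : 0 < γ) (hγ1 : γ < 1)
    (hT : 0 < T) {k g : ℝ → ℝ} (hk : Continuous k) (hg : ∀ t ∈ Ioc 0 T, g t = t ^ (γ - 1) * k t)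
    {A : ℝ → E →L[ℝ] E} (hA : ContinuousOn A (Icc 0 T)) {d : ℝ → E} (hd : ContinuousOn d (Icc 0 T))
    (heq : ∀ t ∈ Icc 0 T, d t = -∫ s in (0:ℝ)..t, g (t - s) • A s (d s)) :
    ∀ t ∈ Icc 0 T, d t = 0 := by
  obtain ⟨M, hM⟩ := exists_norm_le_Icc (T := T) hk.continuousOn
  obtain ⟨L, hL⟩ := exists_norm_le_Icc hA
  have h0T : (0:ℝ) ∈ Icc 0 T := ⟨le_rfl, hT.le⟩
  have hM0 := (norm_nonneg _).trans (hM 0 h0T)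
  have hL0 := (norm_nonneg _).trans (hL 0 h0T)
  obtain ⟨l, hl, hq⟩ := exists_rpow_neg_mul_lt_one (M * L * (T ^ (γ / 2) / (γ / 2))) (half_pos hγ)
  obtain ⟨t₀, ht₀, hmax⟩ := isCompact_Icc.exists_isMaxOn ⟨0, h0T⟩
    ((by fun_prop : Continuous fun t : ℝ => exp (-(l * t))).continuousOn.mul hd.norm)
  set D := exp (-(l * t₀)) * ‖d t₀‖ with hD
  have hD0 : 0 ≤ D := by positivity
  have hbd : ∀ s ∈ Icc 0 T, ‖d s‖ ≤ D * exp (l * s) := by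
    intro s hs
    have h : exp (-(l * s)) * ‖d s‖ ≤ D := hmax hs
    calc ‖d s‖ = exp (-(l * s)) * ‖d s‖ * exp (l * s) := by
          rw [mul_right_comm, ← exp_add, neg_add_cancel, exp_zero, one_mul]
      _ ≤ _ := mul_le_mul_of_nonneg_right h (exp_pos _).le
  have hsub := intervalIntegral.integral_comp_sub_left (a := 0) (b := t₀)
    (fun s => g s • A (t₀ - s) (d (t₀ - s))) t₀
  simp only [sub_sub_cancel, sub_self, sub_zero] at hsub
  set a := M * L * D * exp (l * t₀) * l ^ (-(γ / 2)) with ha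
  have hnorm : ‖d t₀‖ ≤ ∫ s in (0:ℝ)..t₀, a * s ^ (γ / 2 - 1) := by
    rw [heq t₀ ht₀, norm_neg, hsub]
    refine intervalIntegral.norm_integral_le_of_norm_le ht₀.1
      (Filter.Eventually.of_forall fun s hs => ?_)
      ((intervalIntegral.intervalIntegrable_rpow' (by linarith)).const_mul _)
    have hsT : s ∈ Icc 0 T := ⟨hs.1.le, hs.2.trans ht₀.2⟩
    have hts : t₀ - s ∈ Icc 0 T := ⟨by linarith [hs.2], by linarith [hs.1, ht₀.2]⟩
    have hs0 := hs.1
    rw [hg s ⟨hs.1, hsT.2⟩, norm_smul, norm_mul, norm_of_nonneg (by positivity)]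
    have h1 : exp (l * (t₀ - s)) ≤ exp (l * t₀) * (l ^ (-(γ / 2)) * s ^ (-(γ / 2))) := by
      rw [mul_sub, sub_eq_add_neg, exp_add]
      exact mul_le_mul_of_nonneg_left (exp_neg_mul_le_rpow hs0 hl (by positivity) (by linarith))
        (exp_pos _).le
    have h2 : ‖A (t₀ - s) (d (t₀ - s))‖ ≤
        L * (D * (exp (l * t₀) * (l ^ (-(γ / 2)) * s ^ (-(γ / 2))))) :=
      ((A _).le_opNorm _).trans (mul_le_mul (hL _ hts)
        ((hbd _ hts).trans (mul_le_mul_of_nonneg_left h1 hD0)) (norm_nonneg _) hL0)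
    calc _ ≤ s ^ (γ - 1) * M * (L * (D * (exp (l * t₀) * (l ^ (-(γ / 2)) * s ^ (-(γ / 2)))))) :=
          mul_le_mul (mul_le_mul_of_nonneg_left (hM s hsT) (by positivity)) h2 (norm_nonneg _)
            (by positivity)
      _ = _ := by
          rw [ha, show γ / 2 - 1 = (γ - 1) + -(γ / 2) by ring, rpow_add hs0]; ring
  rw [intervalIntegral.integral_const_mul, integral_rpow (Or.inl (by linarith)), sub_add_cancel,
    zero_rpow (half_pos hγ).ne', sub_zero] at hnorm
  have ht₀0 := ht₀.1
  have hDle : D ≤ M * L * (T ^ (γ / 2) / (γ / 2)) * l ^ (-(γ / 2)) * D := by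
    calc D ≤ exp (-(l * t₀)) * (a * (t₀ ^ (γ / 2) / (γ / 2))) :=
          mul_le_mul_of_nonneg_left hnorm (exp_pos _).le
      _ = (exp (-(l * t₀)) * exp (l * t₀)) *
          (M * L * (t₀ ^ (γ / 2) / (γ / 2)) * l ^ (-(γ / 2)) * D) := by rw [ha]; ring
      _ = M * L * (t₀ ^ (γ / 2) / (γ / 2)) * l ^ (-(γ / 2)) * D := by
          rw [← exp_add, neg_add_cancel, exp_zero, one_mul]
      _ ≤ _ := by
          have := ht₀.2
          gcongr
  have hDz : D = 0 := by nlinarith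
  intro t ht
  have h := hbd t ht
  rw [hDz, zero_mul] at h
  exact norm_le_zero_iff.1 h

lemma exists_continuous_extension_Icc {V : Type*} [TopologicalSpace V] {T : ℝ} (hT : 0 ≤ T)
    {f : ℝ → V} (hf : ContinuousOn f (Icc 0 T)) :
    ∃ f' : ℝ → V, Continuous f' ∧ EqOn f' f (Icc 0 T) :=
  ⟨IccExtend hT ((Icc 0 T).domRestrict f), hf.domRestrict.Icc_extend', fun t ht => by
    rw [IccExtend_of_mem _ _ ht]; rfl⟩

lemma exists_extension_of_contDiffOn_Icc {V : Type*} [NormedAddCommGroup V] [NormedSpace ℝ V]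
    {T : ℝ} (hT : 0 < T) {f : ℝ → V} (hf : ContDiffOn ℝ 1 f (Icc 0 T)) :
    ∃ f₁ f' : ℝ → V, Continuous f₁ ∧ Continuous f' ∧ EqOn f₁ f (Icc 0 T) ∧
      ∀ t ∈ Ioo 0 T, HasDerivAt f₁ (f' t) t := by
  obtain ⟨f₁, h1, h2⟩ := exists_continuous_extension_Icc hT.le hf.continuousOn
  obtain ⟨f', h3, h4⟩ := exists_continuous_extension_Icc hT.le
    (hf.continuousOn_derivWithin (uniqueDiffOn_Icc hT) le_rfl)
  refine ⟨f₁, f', h1, h3, h2, fun t ht => ?_⟩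
  have hmem := Icc_mem_nhds ht.1 ht.2
  rw [h4 (Ioo_subset_Icc_self ht)]
  have h5 := ((hf.differentiableOn one_ne_zero t (Ioo_subset_Icc_self ht)).hasDerivWithinAt).hasDerivAt
    hmem
  exact h5.congr_of_eventuallyEq (Filter.eventually_of_mem hmem h2)

lemma intervalIntegrable_kernel_sub_smul {γ T : ℝ} (hγ : 0 < γ) {k g : ℝ → ℝ} (hk : Continuous k)
    (hg : ∀ t ∈ Ioc 0 T, g t = t ^ (γ - 1) * k t) {u : ℝ → E} (hu : ContinuousOn u (Icc 0 T))
    {t : ℝ} (ht : t ∈ Icc 0 T) :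
    IntervalIntegrable (fun s => g (t - s) • u s) volume 0 t := by
  have hgi : IntervalIntegrable g volume 0 t :=
    (intervalIntegrable_rpow_smul hγ hk 0 t).congr fun s hs => by
      rw [uIoc_of_le ht.1] at hs
      exact (hg s ⟨hs.1, hs.2.trans ht.2⟩).symm
  have h := (hgi.comp_sub_left t).symm
  rw [sub_zero, sub_self] at h
  refine h.smul_continuousOn (hu.mono ?_)
  rw [uIcc_of_le ht.1]
  exact Icc_subset_Icc_right ht.2

end Volterra

/-- A square matrix as a continuous linear map, depending linearly on the matrix. -/
noncomputable def matrixCLM (n : ℕ) :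
    (Fin n → Fin n → ℝ) →ₗ[ℝ] ((Fin n → ℝ) →L[ℝ] (Fin n → ℝ)) where
  toFun A := LinearMap.toContinuousLinearMap (Matrix.mulVecLin (Matrix.of A))
  map_add' A B := by
    ext1 x
    exact Matrix.add_mulVec (Matrix.of A) (Matrix.of B) x
  map_smul' r A := by
    ext1 x
    exact Matrix.smul_mulVec r (Matrix.of A) x

lemma matrixCLM_apply {n : ℕ} (A : Fin n → Fin n → ℝ) (c : Fin n → ℝ) :
    matrixCLM n A c = fun i => ∑ j, A i j * c j := rfl


/-- For every `n ∈ ℕ`, `T > 0`, `A ∈ C¹([0,T]; ℝ^{n×n})`,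
`F ∈ C¹([0,T]; ℝⁿ)` and `c₀ ∈ ℝⁿ`, there is a unique `c ∈ C([0,T]; ℝⁿ)` with
`c(0) = c₀`, differentiable on `(0,T]` with `t ↦ t^{1-γ} c'(t)` extending continuously
to `[0,T]`, satisfying `c(t) = c₀ - ∫₀ᵗ g(t-τ)A(τ)c(τ)dτ + ∫₀ᵗ g(t-τ)F(τ)dτ`. -/
theorem stmt_16 (μ : ℝ → ℝ)
    (hμ_int : IntegrableOn μ (Ioo 0 1))
    (hμ_nonneg : ∀ α ∈ Ioo (0:ℝ) 1, 0 ≤ μ α)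
    (hμ_ne : ¬ (∀ᵐ α ∂(volume.restrict (Ioo (0:ℝ) 1)), μ α = 0))
    (hcμ : 0 < ∫ α in Ioo (0:ℝ) 1, μ α)
    (γ : ℝ) (hγ : γ ∈ Ioo (0:ℝ) (1/2))
    (hγμ : (∫ α in Ioo γ (1 - γ), μ α) = ((1 - γ) / 2) * ∫ α in Ioo (0:ℝ) 1, μ α)
    (S C g : ℝ → ℝ)
    (hS : ∀ r : ℝ, S r = ∫ α in Ioo (0:ℝ) 1, Real.sin (π * α) * r ^ α * μ α)
    (hC : ∀ r : ℝ, C r = ∫ α in Ioo (0:ℝ) 1, Real.cos (π * α) * r ^ α * μ α)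
    (hg : ∀ t : ℝ, 0 < t →
      g t = (1/π) * ∫ r in Ioi (0:ℝ), Real.exp (-r * t) * S r / ((S r)^2 + (C r)^2))
    (n : ℕ) (T : ℝ) (hT : 0 < T)
    (A : ℝ → Fin n → Fin n → ℝ) (hA : ContDiffOn ℝ 1 A (Icc 0 T))
    (F : ℝ → Fin n → ℝ) (hF : ContDiffOn ℝ 1 F (Icc 0 T))
    (c₀ : Fin n → ℝ) :
    ∃ c : ℝ → Fin n → ℝ, IsVolterraSol g γ T n A F c₀ c ∧
      ∀ c₂ : ℝ → Fin n → ℝ, IsVolterraSol g γ T n A F c₀ c₂ → EqOn c₂ c (Icc 0 T) := by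
  obtain ⟨hγ0, hγ1⟩ := hγ
  have hγ1' : γ < 1 := by linarith
  have hpos : 0 < ∫ α in Ioo γ (1 - γ), μ α := by
    rw [hγμ]
    exact mul_pos (by linarith) hcμ
  obtain ⟨k₀, hk₀, hgk₀⟩ :=
    exists_continuousOn_kernel_factor hμ_int hμ_nonneg ⟨hγ0, hγ1⟩ hpos hS hC hg
  obtain ⟨k, hk, hkk₀⟩ := exists_continuous_extension_Icc hT.le (hk₀.mono Icc_subset_Ici_self)
  have hgk : ∀ t ∈ Ioc 0 T, g t = t ^ (γ - 1) * k t := fun t ht => by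
    rw [hgk₀ t ht.1, hkk₀ (Ioc_subset_Icc_self ht)]
  have hAm : ContDiffOn ℝ 1 (fun t => matrixCLM n (A t)) (Icc 0 T) :=
    hA.continuousLinearMap_comp (LinearMap.toContinuousLinearMap (matrixCLM n))
  obtain ⟨A₁, A', hA₁, hA', hAA₁, hAd⟩ := exists_extension_of_contDiffOn_Icc hT hAm
  obtain ⟨F₁, F', hF₁, hF', hFF₁, hFd⟩ := exists_extension_of_contDiffOn_Icc hT hF
  obtain ⟨w, hw, hsol⟩ := exists_volterra_sol hγ0 hγ1' hT hk hgk hA₁ hA' hF₁ hF' hAd hFd c₀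
  have hAi : ∀ v : ℝ → Fin n → ℝ, ContinuousOn v (Icc 0 T) → ∀ t ∈ Icc 0 T,
      IntervalIntegrable (fun τ => g (t - τ) • (fun i => ∑ j, A τ i j * v τ j)) volume 0 t :=
    fun v hv t ht => intervalIntegrable_kernel_sub_smul hγ0 hk hgk
      (hAm.continuousOn.clm_apply hv) ht
  have hcc : Continuous fun t => c₀ + ∫ s in (0:ℝ)..t, s ^ (γ - 1) • w s :=
    continuous_const.add (continuous_primitive_rpow_smul hγ0 hw)
  have hc : IsVolterraSol g γ T n A F c₀ fun t => c₀ + ∫ s in (0:ℝ)..t, s ^ (γ - 1) • w s := by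
    refine ⟨hcc.continuousOn, by simp, ⟨fun t => t ^ (γ - 1) • w t, fun t ht => ?_,
      w, hw.continuousOn, fun t ht => ?_⟩, fun t ht => ?_⟩
    · exact ((hasDerivAt_primitive_rpow_smul hγ0 hw ht.1).const_add c₀).hasDerivWithinAt
    · rw [smul_smul, ← rpow_add ht.1]
      simp
    · have hFi := intervalIntegrable_kernel_sub_smul hγ0 hk hgk hF.continuousOn ht
      refine (hsol t ht).trans ?_
      rw [sub_add_eq_add_sub, add_sub_assoc,
        ← intervalIntegral.integral_sub hFi (hAi _ hcc.continuousOn t ht)]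
      congr 1
      refine intervalIntegral.integral_congr fun τ hτ => ?_
      rw [uIcc_of_le ht.1] at hτ
      have hτT : τ ∈ Icc 0 T := ⟨hτ.1, hτ.2.trans ht.2⟩
      rw [hFF₁ hτT, hAA₁ hτT, ← smul_sub]
      rfl
  generalize (fun t => c₀ + ∫ s in (0:ℝ)..t, s ^ (γ - 1) • w s) = c at hc
  refine ⟨c, hc, fun c₂ hc₂ t ht => sub_eq_zero.1 ?_⟩
  refine eq_zero_of_volterra_homogeneous hγ0 hγ1' hT hk hgk hAm.continuousOn
    (hc₂.1.sub hc.1) (fun t ht => ?_) t ht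
  rw [Pi.sub_apply, hc₂.2.2.2 t ht, hc.2.2.2 t ht, add_sub_add_right_eq_sub,
    sub_sub_sub_cancel_left, ← neg_sub,
    ← intervalIntegral.integral_sub (hAi _ hc₂.1 t ht) (hAi _ hc.1 t ht)]
  congr 1
  refine intervalIntegral.integral_congr fun τ _ => ?_
  simp only [Pi.sub_apply, map_sub, matrixCLM_apply, smul_sub]
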